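/- Let Π be an orthogonal projection on ℂ^d, and let {e_i}_{i∈I} ∪ {f_j}_{j∈J} be an orthonormal basis of ℂ^d, i.e. ⟨e_i, e_{i'}⟩ = δ_{i i'}, ⟨f_j, f_{j'}⟩ = δ_{j j'} and ⟨e_i, f_j⟩ = 0 for all indices. Suppose moreover that ⟨e_i, Π e_{i'}⟩ = 0 whenever i ≠ i' and ⟨f_j, Π f_{j'}⟩ = 0 whenever j ≠ j'. Then for all i ∈ I and j ∈ J: if ⟨e_i, Π f_j⟩ ≠ 0 then ⟨e_i, Π e_i⟩ + ⟨f_j, Π f_j⟩ = 1. Consequently, if ⟨e_i, Π f_j⟩ ≠ 0 and ⟨e_i, Π f_{j'}⟩ ≠ 0 for two distinct indices j ≠ j', then ⟨f_j, Π f_j⟩ = ⟨f_{j'}, Π f_{j'}⟩. -/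

import Mathlib

open Matrix

theorem stmt19 (d : ℕ) (Pr : Matrix (Fin d) (Fin d) ℂ)
    (hPr : Pr.IsHermitian) (hPr2 : Pr * Pr = Pr)
    (ι κ : Type*) [Fintype ι] [Fintype κ] [DecidableEq ι] [DecidableEq κ]
    (e : ι → (Fin d → ℂ)) (f : κ → (Fin d → ℂ))
    -- orthonormality
    (he : ∀ i i', star (e i) ⬝ᵥ e i' = if i = i' then 1 else 0)
    (hf : ∀ j j', star (f j) ⬝ᵥ f j' = if j = j' then 1 else 0)
    (hef : ∀ i j, star (e i) ⬝ᵥ f j = 0)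
    -- the combined family spans `ℂ^d`, so it is an orthonormal basis
    (hspan : Submodule.span ℂ (Set.range e ∪ Set.range f) = ⊤)
    -- `Pr` is diagonal with respect to each of the two families
    (hde : ∀ i i', i ≠ i' → star (e i) ⬝ᵥ Pr.mulVec (e i') = 0)
    (hdf : ∀ j j', j ≠ j' → star (f j) ⬝ᵥ Pr.mulVec (f j') = 0) :
    (∀ i j, star (e i) ⬝ᵥ Pr.mulVec (f j) ≠ 0 →
      star (e i) ⬝ᵥ Pr.mulVec (e i) + star (f j) ⬝ᵥ Pr.mulVec (f j) = 1) ∧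
    (∀ i j j', j ≠ j' →
      star (e i) ⬝ᵥ Pr.mulVec (f j) ≠ 0 → star (e i) ⬝ᵥ Pr.mulVec (f j') ≠ 0 →
      star (f j) ⬝ᵥ Pr.mulVec (f j) = star (f j') ⬝ᵥ Pr.mulVec (f j')) := by
  have hfe : ∀ j i, star (f j) ⬝ᵥ e i = 0 := by
    intro j i
    rw [Matrix.star_dotProduct, hef, star_zero]
  have hexp : ∀ v : Fin d → ℂ,
      v = ∑ i, (star (e i) ⬝ᵥ v) • e i + ∑ j, (star (f j) ⬝ᵥ v) • f j := by
    intro v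
    have hv : v ∈ Submodule.span ℂ (Set.range e ∪ Set.range f) := by
      rw [hspan]; trivial
    induction hv using Submodule.span_induction with
    | mem x hx =>
      rcases hx with ⟨i, rfl⟩ | ⟨j, rfl⟩
      · simp [he, hfe]
      · simp [hf, hef]
    | zero => simp
    | add x y _ _ hx hy =>
      simp only [dotProduct_add, add_smul, Finset.sum_add_distrib]
      nth_rewrite 1 [hx, hy]
      abel
    | smul a x _ hx =>
      simp only [dotProduct_smul, smul_assoc, ← Finset.smul_sum, ← smul_add]
      rw [← hx]
  have key : ∀ i j, star (e i) ⬝ᵥ Pr.mulVec (f j) ≠ 0 →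
      star (e i) ⬝ᵥ Pr.mulVec (e i) + star (f j) ⬝ᵥ Pr.mulVec (f j) = 1 := by
    intro i j hc
    have h1 : star (e i) ⬝ᵥ Pr.mulVec (Pr.mulVec (f j)) = star (e i) ⬝ᵥ Pr.mulVec (f j) := by
      rw [Matrix.mulVec_mulVec, hPr2]
    have h2 : star (e i) ⬝ᵥ Pr.mulVec (Pr.mulVec (f j)) =
        ∑ i', (star (e i') ⬝ᵥ Pr.mulVec (f j)) * (star (e i) ⬝ᵥ Pr.mulVec (e i'))
        + ∑ j', (star (f j') ⬝ᵥ Pr.mulVec (f j)) * (star (e i) ⬝ᵥ Pr.mulVec (f j')) := by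
      conv_lhs => rw [hexp (Pr.mulVec (f j))]
      simp only [Matrix.mulVec_add, Matrix.mulVec_sum, Matrix.mulVec_smul, dotProduct_add,
        dotProduct_sum, dotProduct_smul, smul_eq_mul]
    rw [Finset.sum_eq_single i (fun b _ hb => by rw [hde i b hb.symm, mul_zero]) (by simp),
      Finset.sum_eq_single j (fun b _ hb => by rw [hdf b j hb, zero_mul]) (by simp), h1] at h2
    apply mul_right_cancel₀ hc
    linear_combination -h2
  refine ⟨key, fun i j j' _ h h' => ?_⟩
  linear_combination key i j h - key i j' h'
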